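/- Let α ∈ (1,∞) and let p be a probability distribution on A₁×B₁×A₂×B₂ (finite sets) whose marginal on A₁×B₁×B₂ factorizes as p(a₁,b₁,b₂) = p_{A₁B₁}(a₁,b₁)·p_{B₂}(b₂) for all a₁,b₁,b₂. Then H_α^↑(A₁A₂|B₁B₂)_p ≥ H_α^↑(A₁|B₁)_p + inf over all probability distributions ν on A₁×B₁×A₂×B₂ such that supp(ν_{A₁B₁}) = supp(p_{A₁B₁}) and ν(a₂,b₂|a₁,b₁) = p(a₂,b₂|a₁,b₁) for all (a₁,b₁) ∈ supp(p_{A₁B₁}) of H_α(A₂|B₂↑(A₁B₁)↓)_ν, where H_α(A₂|B₂↑(A₁B₁)↓)_ν := (α/(1−α))·log( Σ_{b₂} ν_{B₂}(b₂)·[ Σ_{a₁,b₁} ν_{A₁B₁|B₂}(a₁,b₁|b₂)·Σ_{a₂} ν_{A₂|A₁B₁B₂}(a₂|a₁,b₁,b₂)^α ]^{1/α} ). -/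

import Mathlib

/-- Optimized classical conditional Rényi entropy `H_α^↑(A|B)` of a joint
distribution `p`, where `p a b` is the probability of the pair `(a, b)`.
Terms with zero marginal probability vanish automatically. -/
noncomputable def Hup (α : ℝ) {A B : Type} [Fintype A] [Fintype B] (p : A → B → ℝ) : ℝ :=
  (α / (1 - α)) * Real.logb 2
    (∑ b, (∑ a, p a b) * (∑ a, (p a b / (∑ a', p a' b)) ^ α) ^ (1 / α : ℝ))

open Finset

/-- The argument of the logarithm in `Hup` is positive. -/
lemma hupSum_pos {α : ℝ} {A B : Type} [Fintype A] [Fintype B] {p : A → B → ℝ}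
    (hp0 : ∀ a b, 0 ≤ p a b) (hp1 : ∑ b, ∑ a, p a b = 1) :
    0 < ∑ b, (∑ a, p a b) * (∑ a, (p a b / (∑ a', p a' b)) ^ α) ^ (1 / α : ℝ) := by
  have hm : ∀ b, 0 ≤ ∑ a, p a b := fun b => sum_nonneg fun a _ => hp0 a b
  have hr : ∀ a b, 0 ≤ (p a b / ∑ a', p a' b) ^ α := fun a b =>
    Real.rpow_nonneg (div_nonneg (hp0 a b) (hm b)) _
  obtain ⟨b, -, hb⟩ := exists_ne_zero_of_sum_ne_zero (hp1.trans_ne one_ne_zero)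
  obtain ⟨a, -, ha⟩ := exists_ne_zero_of_sum_ne_zero hb
  have hbpos : 0 < ∑ a, p a b := (hm b).lt_of_ne' hb
  refine sum_pos' (fun b _ => mul_nonneg (hm b)
    (Real.rpow_nonneg (sum_nonneg fun a _ => hr a b) _)) ⟨b, mem_univ _, mul_pos hbpos ?_⟩
  exact Real.rpow_pos_of_pos (sum_pos' (fun a _ => hr a b) ⟨a, mem_univ _,
    Real.rpow_pos_of_pos (div_pos ((hp0 a b).lt_of_ne' ha) hbpos) _⟩) _

/-- The tilted distribution, proportional to
`p_B(b) · (∑ a, p(a|b)^α)^(1/α) · p(a|b)^α / ∑ a, p(a|b)^α`. -/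
noncomputable def tilt (α : ℝ) {A B : Type} [Fintype A] [Fintype B] (q : A → B → ℝ)
    (a : A) (b : B) : ℝ :=
  (∑ a, q a b) * (∑ a, (q a b / ∑ a', q a' b) ^ α) ^ (1 / α : ℝ) /
      (∑ b, (∑ a, q a b) * (∑ a, (q a b / (∑ a', q a' b)) ^ α) ^ (1 / α : ℝ)) *
    ((q a b / ∑ a', q a' b) ^ α / ∑ a, (q a b / ∑ a', q a' b) ^ α)

section Tilt

variable {α : ℝ} {A B : Type} [Fintype A] [Fintype B] {q : A → B → ℝ}

lemma tilt_nonneg (hq0 : ∀ a b, 0 ≤ q a b) (a : A) (b : B) : 0 ≤ tilt α q a b := by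
  have hm : ∀ b, 0 ≤ ∑ a, q a b := fun b => sum_nonneg fun a _ => hq0 a b
  have hr : ∀ a b, 0 ≤ (q a b / ∑ a', q a' b) ^ α := fun a b =>
    Real.rpow_nonneg (div_nonneg (hq0 a b) (hm b)) _
  have hG : ∀ b, 0 ≤ ∑ a, (q a b / ∑ a', q a' b) ^ α := fun b => sum_nonneg fun a _ => hr a b
  have hT := fun b => mul_nonneg (hm b) (Real.rpow_nonneg (hG b) (1 / α))
  exact mul_nonneg (div_nonneg (hT b) (sum_nonneg fun b _ => hT b)) (div_nonneg (hr a b) (hG b))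

lemma tilt_eq_zero (hα : 1 < α) {a : A} {b : B} (h : q a b = 0) : tilt α q a b = 0 := by
  simp [tilt, h, Real.zero_rpow (by linarith : α ≠ 0)]

lemma tilt_pos (hq0 : ∀ a b, 0 ≤ q a b) (hq1 : ∑ b, ∑ a, q a b = 1)
    {a : A} {b : B} (h : q a b ≠ 0) : 0 < tilt α q a b := by
  have hm : ∀ b, 0 ≤ ∑ a, q a b := fun b => sum_nonneg fun a _ => hq0 a b
  have hqp : 0 < q a b := (hq0 a b).lt_of_ne' h
  have hmp : 0 < ∑ a, q a b := sum_pos' (fun a _ => hq0 a b) ⟨a, mem_univ _, hqp⟩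
  have hr : 0 < (q a b / ∑ a', q a' b) ^ α := Real.rpow_pos_of_pos (div_pos hqp hmp) _
  have hG : 0 < ∑ a, (q a b / ∑ a', q a' b) ^ α :=
    sum_pos' (fun a _ => Real.rpow_nonneg (div_nonneg (hq0 a b) (hm b)) _) ⟨a, mem_univ _, hr⟩
  exact mul_pos (div_pos (mul_pos hmp (Real.rpow_pos_of_pos hG _)) (hupSum_pos hq0 hq1))
    (div_pos hr hG)

lemma sum_tilt_fst (hα : 1 < α) (b : B) :
    ∑ a, tilt α q a b = (∑ a, q a b) * (∑ a, (q a b / ∑ a', q a' b) ^ α) ^ (1 / α : ℝ) /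
      (∑ b, (∑ a, q a b) * (∑ a, (q a b / (∑ a', q a' b)) ^ α) ^ (1 / α : ℝ)) := by
  simp only [tilt]
  rw [← mul_sum, ← sum_div]
  by_cases h : ∑ a, (q a b / ∑ a', q a' b) ^ α = 0
  · rw [h, Real.zero_rpow (by positivity)]
    simp
  · rw [div_self h, mul_one]

lemma sum_tilt (hα : 1 < α) (hq0 : ∀ a b, 0 ≤ q a b) (hq1 : ∑ b, ∑ a, q a b = 1) :
    ∑ b, ∑ a, tilt α q a b = 1 := by
  simp only [sum_tilt_fst hα]
  rw [← sum_div]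
  exact div_self (hupSum_pos hq0 hq1).ne'

/-- Jensen's inequality for the tilted distribution. -/
lemma sum_weighted_le_tilt (hα : 1 < α) (hq0 : ∀ a b, 0 ≤ q a b)
    (hq1 : ∑ b, ∑ a, q a b = 1) {S : A → B → ℝ} (hS : ∀ a b, 0 ≤ S a b) :
    ∑ b, (∑ a, q a b) * (∑ a, (q a b / ∑ a', q a' b) ^ α * S a b) ^ (1 / α : ℝ) ≤
      (∑ b, (∑ a, q a b) * (∑ a, (q a b / (∑ a', q a' b)) ^ α) ^ (1 / α : ℝ)) *
        (∑ b, ∑ a, tilt α q a b * S a b) ^ (1 / α : ℝ) := by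
  have hα0 : α ≠ 0 := by linarith
  have hm : ∀ b, 0 ≤ ∑ a, q a b := fun b => sum_nonneg fun a _ => hq0 a b
  have hTpos := hupSum_pos (α := α) hq0 hq1
  have hw0 : ∀ b, 0 ≤ ∑ a, tilt α q a b := fun b => sum_nonneg fun a _ => tilt_nonneg hq0 a b
  have hw1 := sum_tilt hα hq0 hq1
  have htilt : ∀ a b, tilt α q a b = (∑ a, tilt α q a b) *
      ((q a b / ∑ a', q a' b) ^ α / ∑ a, (q a b / ∑ a', q a' b) ^ α) := fun a b => by
    rw [sum_tilt_fst hα]; rfl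
  have hw := fun b => sum_tilt_fst (q := q) hα b
  set T := ∑ b, (∑ a, q a b) * (∑ a, (q a b / (∑ a', q a' b)) ^ α) ^ (1 / α : ℝ) with hT
  set c : A → B → ℝ := fun a b => (q a b / ∑ a', q a' b) ^ α
  have hc0 : ∀ a b, 0 ≤ c a b := fun a b =>
    Real.rpow_nonneg (div_nonneg (hq0 a b) (hm b)) _
  have hG : ∀ b, 0 ≤ ∑ a, c a b := fun b => sum_nonneg fun a _ => hc0 a b
  set Z : B → ℝ := fun b => ∑ a, c a b / (∑ a, c a b) * S a b with hZ
  have hZ0 : ∀ b, 0 ≤ Z b := fun b =>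
    sum_nonneg fun a _ => mul_nonneg (div_nonneg (hc0 a b) (hG b)) (hS a b)
  have hcS : ∀ b, ∑ a, c a b * S a b = (∑ a, c a b) * Z b := by
    intro b
    rw [hZ, mul_sum]
    refine sum_congr rfl fun a _ => ?_
    by_cases h : ∑ a, c a b = 0
    · rw [h, (sum_eq_zero_iff_of_nonneg fun a _ => hc0 a b).1 h a (mem_univ a)]
      simp
    · field_simp
  have hJ := Real.arith_mean_le_rpow_mean univ (fun b => ∑ a, tilt α q a b)
    (fun b => Z b ^ (1 / α : ℝ)) (fun b _ => hw0 b) hw1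
    (fun b _ => Real.rpow_nonneg (hZ0 b) _) hα.le
  have hpow : ∀ b, (Z b ^ (1 / α : ℝ)) ^ α = Z b := fun b => by
    rw [← Real.rpow_mul (hZ0 b), one_div_mul_cancel hα0, Real.rpow_one]
  simp only [hpow] at hJ
  have hR : ∑ b, ∑ a, tilt α q a b * S a b = ∑ b, (∑ a, tilt α q a b) * Z b := by
    refine sum_congr rfl fun b _ => ?_
    rw [hZ, mul_sum]
    refine sum_congr rfl fun a _ => ?_
    rw [htilt a b, mul_assoc]
  rw [hR]
  refine le_trans (le_of_eq ?_) (mul_le_mul_of_nonneg_left hJ hTpos.le)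
  rw [mul_sum]
  refine sum_congr rfl fun b _ => ?_
  change (∑ a, q a b) * (∑ a, c a b * S a b) ^ (1 / α : ℝ) = _
  rw [hcS b, Real.mul_rpow (hG b) (hZ0 b), hw b]
  change _ = T * ((∑ a, q a b) * (∑ a, c a b) ^ (1 / α : ℝ) / T * _)
  field_simp

end Tilt

/-- The sum of `α`-th powers of the normalization of `x` is at most one. -/
lemma sum_div_sum_rpow_le_one {α : ℝ} (hα : 1 < α) {A : Type} [Fintype A] {x : A → ℝ}
    (hx : ∀ a, 0 ≤ x a) : ∑ a, (x a / ∑ a', x a') ^ α ≤ 1 := by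
  have hs : 0 ≤ ∑ a, x a := sum_nonneg fun a _ => hx a
  calc ∑ a, (x a / ∑ a', x a') ^ α ≤ ∑ a, x a / ∑ a', x a' :=
        sum_le_sum fun a _ => Real.rpow_le_self_of_le_one (div_nonneg (hx a) hs)
          (div_le_one_of_le₀ (single_le_sum (fun a _ => hx a) (mem_univ a)) hs) hα.le
    _ ≤ 1 := by rw [← sum_div]; exact div_self_le_one _

/-- The partially optimized conditional Rényi entropy is nonnegative. -/
lemma partialEntropy_nonneg {A₁ B₁ A₂ B₂ : Type} [Fintype A₁] [Fintype B₁] [Fintype A₂]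
    [Fintype B₂] {α : ℝ} (hα : 1 < α) {ν : A₁ → B₁ → A₂ → B₂ → ℝ}
    (hν0 : ∀ a₁ b₁ a₂ b₂, 0 ≤ ν a₁ b₁ a₂ b₂)
    (hν1 : ∑ a₁, ∑ b₁, ∑ a₂, ∑ b₂, ν a₁ b₁ a₂ b₂ = 1) :
    0 ≤ (α / (1 - α)) * Real.logb 2
          (∑ b₂, (∑ a₁, ∑ b₁, ∑ a₂, ν a₁ b₁ a₂ b₂) *
            (∑ a₁, ∑ b₁,
              ((∑ a₂, ν a₁ b₁ a₂ b₂) / (∑ a₁', ∑ b₁', ∑ a₂', ν a₁' b₁' a₂' b₂)) *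
                ∑ a₂, (ν a₁ b₁ a₂ b₂ / (∑ a₂', ν a₁ b₁ a₂' b₂)) ^ α) ^ (1 / α : ℝ)) := by
  have hm2 : ∀ a₁ b₁ b₂, 0 ≤ ∑ a₂, ν a₁ b₁ a₂ b₂ := fun a₁ b₁ b₂ =>
    sum_nonneg fun a₂ _ => hν0 _ _ _ _
  have hm : ∀ b₂, 0 ≤ ∑ a₁, ∑ b₁, ∑ a₂, ν a₁ b₁ a₂ b₂ := fun b₂ =>
    sum_nonneg fun a₁ _ => sum_nonneg fun b₁ _ => hm2 _ _ _
  have hS0 : ∀ a₁ b₁ b₂, 0 ≤ ∑ a₂, (ν a₁ b₁ a₂ b₂ / (∑ a₂', ν a₁ b₁ a₂' b₂)) ^ α :=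
    fun a₁ b₁ b₂ => sum_nonneg fun a₂ _ => Real.rpow_nonneg (div_nonneg (hν0 _ _ _ _) (hm2 _ _ _)) _
  have hI0 : ∀ b₂, 0 ≤ ∑ a₁, ∑ b₁,
      ((∑ a₂, ν a₁ b₁ a₂ b₂) / (∑ a₁', ∑ b₁', ∑ a₂', ν a₁' b₁' a₂' b₂)) *
        ∑ a₂, (ν a₁ b₁ a₂ b₂ / (∑ a₂', ν a₁ b₁ a₂' b₂)) ^ α := fun b₂ =>
    sum_nonneg fun a₁ _ => sum_nonneg fun b₁ _ =>
      mul_nonneg (div_nonneg (hm2 _ _ _) (hm _)) (hS0 _ _ _)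
  refine mul_nonneg_of_nonpos_of_nonpos
    (div_nonpos_of_nonneg_of_nonpos (by linarith) (by linarith)) ?_
  refine Real.logb_nonpos one_lt_two
    (sum_nonneg fun b₂ _ => mul_nonneg (hm b₂) (Real.rpow_nonneg (hI0 b₂) _)) ?_
  have htot : ∑ b₂, ∑ a₁, ∑ b₁, ∑ a₂, ν a₁ b₁ a₂ b₂ = 1 := by
    rw [← hν1, sum_comm]
    refine sum_congr rfl fun a₁ _ => ?_
    rw [sum_comm]
    exact sum_congr rfl fun b₁ _ => sum_comm
  refine (sum_le_sum fun b₂ _ => ?_).trans htot.le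
  refine mul_le_of_le_one_right (hm b₂) (Real.rpow_le_one (hI0 b₂) ?_ (by positivity))
  calc _ ≤ ∑ a₁, ∑ b₁,
        (∑ a₂, ν a₁ b₁ a₂ b₂) / (∑ a₁', ∑ b₁', ∑ a₂', ν a₁' b₁' a₂' b₂) :=
        sum_le_sum fun a₁ _ => sum_le_sum fun b₁ _ =>
          mul_le_of_le_one_right (div_nonneg (hm2 _ _ _) (hm _))
            (sum_div_sum_rpow_le_one hα fun a₂ => hν0 _ _ _ _)
    _ ≤ 1 := by
        simp only [← sum_div]
        exact div_self_le_one _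

/-- **classical tightened chain rule.** If the marginal of the
probability distribution `p` on `A₁ × B₁ × B₂` factorizes as
`p(a₁,b₁,b₂) = p_{A₁B₁}(a₁,b₁)·p_{B₂}(b₂)`, then
`H_α^↑(A₁A₂|B₁B₂)_p ≥ H_α^↑(A₁|B₁)_p + inf_ν H_α(A₂|B₂↑(A₁B₁)↓)_ν`,
the infimum being over probability distributions `ν` on `A₁ × B₁ × A₂ × B₂` with
`supp(ν_{A₁B₁}) = supp(p_{A₁B₁})` and `ν(a₂,b₂|a₁,b₁) = p(a₂,b₂|a₁,b₁)` on the
support, where the partially optimized entropy treats `B₂` as the up register and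
the classical past `(A₁,B₁)` as the down register. -/
theorem stmt14 {A₁ B₁ A₂ B₂ : Type} [Fintype A₁] [Fintype B₁] [Fintype A₂] [Fintype B₂]
    (α : ℝ) (hα : 1 < α)
    (p : A₁ → B₁ → A₂ → B₂ → ℝ)
    (hp0 : ∀ a₁ b₁ a₂ b₂, 0 ≤ p a₁ b₁ a₂ b₂)
    (hp1 : ∑ a₁, ∑ b₁, ∑ a₂, ∑ b₂, p a₁ b₁ a₂ b₂ = 1)
    (hfact : ∀ a₁ b₁ b₂, (∑ a₂, p a₁ b₁ a₂ b₂) =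
      (∑ a₂, ∑ b₂', p a₁ b₁ a₂ b₂') * (∑ a₁', ∑ b₁', ∑ a₂, p a₁' b₁' a₂ b₂)) :
    Hup α (fun (a : A₁ × A₂) (b : B₁ × B₂) => p a.1 b.1 a.2 b.2) ≥
      Hup α (fun a₁ b₁ => ∑ a₂, ∑ b₂, p a₁ b₁ a₂ b₂) +
      sInf {x : ℝ | ∃ ν : A₁ → B₁ → A₂ → B₂ → ℝ,
        (∀ a₁ b₁ a₂ b₂, 0 ≤ ν a₁ b₁ a₂ b₂) ∧
        (∑ a₁, ∑ b₁, ∑ a₂, ∑ b₂, ν a₁ b₁ a₂ b₂) = 1 ∧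
        (∀ a₁ b₁, (∑ a₂, ∑ b₂, ν a₁ b₁ a₂ b₂) ≠ 0 ↔ (∑ a₂, ∑ b₂, p a₁ b₁ a₂ b₂) ≠ 0) ∧
        (∀ a₁ b₁, (∑ a₂, ∑ b₂, p a₁ b₁ a₂ b₂) ≠ 0 → ∀ a₂ b₂,
          ν a₁ b₁ a₂ b₂ / (∑ a₂', ∑ b₂', ν a₁ b₁ a₂' b₂') =
            p a₁ b₁ a₂ b₂ / (∑ a₂', ∑ b₂', p a₁ b₁ a₂' b₂')) ∧
        x = (α / (1 - α)) * Real.logb 2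
          (∑ b₂, (∑ a₁, ∑ b₁, ∑ a₂, ν a₁ b₁ a₂ b₂) *
            (∑ a₁, ∑ b₁,
              ((∑ a₂, ν a₁ b₁ a₂ b₂) / (∑ a₁', ∑ b₁', ∑ a₂', ν a₁' b₁' a₂' b₂)) *
                ∑ a₂, (ν a₁ b₁ a₂ b₂ / (∑ a₂', ν a₁ b₁ a₂' b₂)) ^ α) ^ (1 / α : ℝ))} := by
  have hα0 : α ≠ 0 := by linarith
  set q : A₁ → B₁ → ℝ := fun a₁ b₁ => ∑ a₂, ∑ b₂, p a₁ b₁ a₂ b₂ with hq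
  set r : B₂ → ℝ := fun b₂ => ∑ a₁, ∑ b₁, ∑ a₂, p a₁ b₁ a₂ b₂ with hr
  change ∀ a₁ b₁ b₂, (∑ a₂, p a₁ b₁ a₂ b₂) = q a₁ b₁ * r b₂ at hfact
  have hq0 : ∀ a b, 0 ≤ q a b := fun a b =>
    sum_nonneg fun _ _ => sum_nonneg fun _ _ => hp0 _ _ _ _
  have hr0 : ∀ b, 0 ≤ r b := fun b =>
    sum_nonneg fun _ _ => sum_nonneg fun _ _ => sum_nonneg fun _ _ => hp0 _ _ _ _
  have hq1 : ∑ b, ∑ a, q a b = 1 := by rw [sum_comm]; exact hp1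
  have hpq : ∀ a b, q a b = 0 → ∀ a₂ b₂, p a b a₂ b₂ = 0 := fun a b h a₂ b₂ =>
    (sum_eq_zero_iff_of_nonneg fun _ _ => hp0 _ _ _ _).1
      ((sum_eq_zero_iff_of_nonneg fun _ _ => sum_nonneg fun _ _ => hp0 _ _ _ _).1 h a₂
        (mem_univ _)) b₂ (mem_univ _)
  set S : B₂ → A₁ → B₁ → ℝ := fun b₂ a₁ b₁ => ∑ a₂, (p a₁ b₁ a₂ b₂ / (q a₁ b₁ * r b₂)) ^ α with hS
  have hS0 : ∀ b₂ a b, 0 ≤ S b₂ a b := fun b₂ a b => sum_nonneg fun _ _ =>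
    Real.rpow_nonneg (div_nonneg (hp0 _ _ _ _) (mul_nonneg (hq0 _ _) (hr0 _))) _
  set ν₁ : A₁ → B₁ → ℝ := tilt α q with hν₁
  set ν : A₁ → B₁ → A₂ → B₂ → ℝ := fun a₁ b₁ a₂ b₂ => ν₁ a₁ b₁ * (p a₁ b₁ a₂ b₂ / q a₁ b₁) with hν
  have hν₁z : ∀ a b, q a b = 0 → ν₁ a b = 0 := fun a b h => tilt_eq_zero hα h
  have hν₁nz : ∀ a b, q a b ≠ 0 → ν₁ a b ≠ 0 := fun a b h => (tilt_pos hq0 hq1 h).ne'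
  have hνq : ∀ a b, ∑ a₂, ∑ b₂, ν a b a₂ b₂ = ν₁ a b := by
    intro a b
    simp only [hν, ← mul_sum, ← sum_div]
    change ν₁ a b * (q a b / q a b) = _
    by_cases h : q a b = 0
    · rw [hν₁z a b h, zero_mul]
    · rw [div_self h, mul_one]
  have hν2 : ∀ a b b₂, ∑ a₂, ν a b a₂ b₂ = ν₁ a b * r b₂ := by
    intro a b b₂
    simp only [hν, ← mul_sum, ← sum_div, hfact]
    by_cases h : q a b = 0
    · rw [hν₁z a b h, zero_mul, zero_mul]
    · rw [mul_div_cancel_left₀ _ h]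
  have hν₁sum : ∑ a, ∑ b, ν₁ a b = 1 := by rw [sum_comm]; exact sum_tilt hα hq0 hq1
  have hνr : ∀ b₂, ∑ a, ∑ b, ν₁ a b * r b₂ = r b₂ := by
    intro b₂
    simp only [← sum_mul, hν₁sum, one_mul]
  have hνS : ∀ a b b₂, ∑ a₂, (ν a b a₂ b₂ / (ν₁ a b * r b₂)) ^ α = S b₂ a b := by
    intro a b b₂
    refine sum_congr rfl fun a₂ _ => ?_
    congr 1
    by_cases h : q a b = 0
    · simp [hν, hν₁z a b h, h]
    · have h' := hν₁nz a b h
      simp only [hν]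
      rw [mul_div_mul_left _ _ h', div_div]
  have hν0 : ∀ a₁ b₁ a₂ b₂, 0 ≤ ν a₁ b₁ a₂ b₂ := fun a b a₂ b₂ =>
    mul_nonneg (tilt_nonneg hq0 a b) (div_nonneg (hp0 _ _ _ _) (hq0 _ _))
  set X : ℝ := ∑ b₂, r b₂ * (∑ b, ∑ a, ν₁ a b * S b₂ a b) ^ (1 / α : ℝ) with hX
  set T : ℝ := ∑ b, (∑ a, q a b) * (∑ a, (q a b / (∑ a', q a' b)) ^ α) ^ (1 / α : ℝ) with hT
  refine ge_iff_le.2 (le_trans (add_le_add_right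
    (csInf_le (a := (α / (1 - α)) * Real.logb 2 X) ?_ ?_) _) ?_)
  · refine ⟨0, ?_⟩
    rintro x ⟨ν, h0, h1, -, -, rfl⟩
    exact partialEntropy_nonneg hα h0 h1
  · refine ⟨ν, hν0, by simp only [hνq, hν₁sum],
      fun a b => by rw [hνq]; exact ⟨fun h h' => h (hν₁z a b h'), hν₁nz a b⟩,
      fun a b h a₂ b₂ => by rw [hνq, mul_div_cancel_left₀ _ (hν₁nz a b h)], ?_⟩
    congr 2
    refine sum_congr rfl fun b₂ _ => ?_
    simp only [hν2, hνr, hνS]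
    by_cases h : r b₂ = 0
    · simp [h]
    · rw [sum_comm]
      simp only [mul_div_cancel_right₀ _ h]
  have hmarg : ∀ b : B₁ × B₂, ∑ a : A₁ × A₂, p a.1 b.1 a.2 b.2 = (∑ a, q a b.1) * r b.2 := by
    intro b
    rw [Fintype.sum_prod_type, sum_mul]
    exact sum_congr rfl fun a _ => hfact a b.1 b.2
  have hcond : ∀ b : B₁ × B₂, ∑ a : A₁ × A₂,
      (p a.1 b.1 a.2 b.2 / ((∑ a, q a b.1) * r b.2)) ^ α =
        ∑ a, (q a b.1 / ∑ a', q a' b.1) ^ α * S b.2 a b.1 := by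
    intro b
    rw [Fintype.sum_prod_type]
    refine sum_congr rfl fun a _ => ?_
    refine Eq.trans ?_ (mul_sum _ _ _).symm
    refine sum_congr rfl fun a₂ _ => ?_
    rw [← Real.mul_rpow (div_nonneg (hq0 _ _) (sum_nonneg fun _ _ => hq0 _ _))
      (div_nonneg (hp0 _ _ _ _) (mul_nonneg (hq0 _ _) (hr0 _)))]
    congr 1
    by_cases h : q a b.1 = 0
    · simp [hpq _ _ h]
    · rw [div_mul_div_comm, mul_left_comm, mul_div_mul_left _ _ h]
  have hLpos := hupSum_pos (α := α) (p := fun (a : A₁ × A₂) (b : B₁ × B₂) => p a.1 b.1 a.2 b.2)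
    (fun _ _ => hp0 _ _ _ _) (by
      simp only [hmarg, Fintype.sum_prod_type, ← mul_sum, ← sum_mul, hq1, one_mul]
      rw [← hp1, hr, sum_comm]
      refine sum_congr rfl fun a₁ _ => ?_
      rw [sum_comm]
      exact sum_congr rfl fun b₁ _ => sum_comm)
  have hTpos : 0 < T := hupSum_pos hq0 hq1
  simp only [Hup]
  simp only [hmarg, hcond] at hLpos ⊢
  set L : ℝ := ∑ b : B₁ × B₂, (∑ a, q a b.1) * r b.2 *
    (∑ a, (q a b.1 / ∑ a', q a' b.1) ^ α * S b.2 a b.1) ^ (1 / α : ℝ) with hL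
  have hLX : L ≤ T * X := by
    rw [hL, Fintype.sum_prod_type_right, hX, mul_sum]
    refine sum_le_sum fun b₂ _ => ?_
    have := mul_le_mul_of_nonneg_left
      (sum_weighted_le_tilt hα hq0 hq1 (S := S b₂) (hS0 b₂)) (hr0 b₂)
    rw [mul_left_comm]
    refine le_trans (le_of_eq ?_) this
    rw [mul_sum]
    exact sum_congr rfl fun b _ => by ring
  have hXpos : 0 < X := pos_of_mul_pos_right (hLpos.trans_le hLX) hTpos.le
  rw [← mul_add, ← Real.logb_mul hTpos.ne' hXpos.ne']
  exact mul_le_mul_of_nonpos_left (Real.logb_le_logb_of_le one_lt_two hLpos hLX)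
    (div_nonpos_of_nonneg_of_nonpos (by linarith) (by linarith))
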